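/- If W_n ~ W_p(a_n) with a_n → ∞, then a_n^{−1/2}(W_n − a_n I_p) converges in distribution to GUE_p. -/

import Mathlib

open MeasureTheory Filter
open scoped ComplexOrder ENNReal Topology

attribute [local instance] Classical.propDecidable

noncomputable instance matrixMeasureSpace (p : ℕ) : MeasureSpace (Matrix (Fin p) (Fin p) ℂ) :=
  inferInstanceAs (MeasureSpace (Fin p → Fin p → ℂ))

/-- Parametrization of Hermitian matrices by their diagonal (real) entries and their
strictly upper triangular (complex) entries. -/
noncomputable def hermMk (p : ℕ)
    (x : (Fin p → ℝ) × ({q : Fin p × Fin p // q.1 < q.2} → ℂ)) :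
    Matrix (Fin p) (Fin p) ℂ :=
  Matrix.of fun i j =>
    if h : i < j then x.2 ⟨(i, j), h⟩
    else if h' : j < i then star (x.2 ⟨(j, i), h'⟩)
    else (x.1 i : ℂ)

/-- Lebesgue measure `∏_{i ≤ j} dx_{ij}^Re ∏_{i < j} dx_{ij}^Im` on the set of
Hermitian `p × p` complex matrices. -/
noncomputable def hermLebesgue (p : ℕ) : Measure (Matrix (Fin p) (Fin p) ℂ) :=
  Measure.map (hermMk p) volume

/-- Normalization of a measure into a probability measure. -/
noncomputable def mnormalize {α : Type*} [MeasurableSpace α] (μ : Measure α) : Measure α :=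
  (μ Set.univ)⁻¹ • μ

/-- The complex matrix Beta distribution `Beta_p(α, β)`, with density proportional to
`det(X)^(α-p) det(I-X)^(β-p)` on Hermitian matrices `0 < X < I`. -/
noncomputable def matrixBeta (p : ℕ) (α β : ℝ) : Measure (Matrix (Fin p) (Fin p) ℂ) :=
  mnormalize <| (hermLebesgue p).withDensity fun X =>
    if X.PosDef ∧ ((1 : Matrix (Fin p) (Fin p) ℂ) - X).PosDef then
      ENNReal.ofReal (Real.rpow X.det.re (α - p) * Real.rpow (1 - X).det.re (β - p))
    else 0

/-- The complex Wishart distribution `W_p(a)`, with density proportional to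
`det(X)^(a-p) e^(-tr X)` on positive definite Hermitian matrices. -/
noncomputable def wishart (p : ℕ) (a : ℝ) : Measure (Matrix (Fin p) (Fin p) ℂ) :=
  mnormalize <| (hermLebesgue p).withDensity fun X =>
    if X.PosDef then
      ENNReal.ofReal (Real.rpow X.det.re (a - p) * Real.exp (-X.trace.re))
    else 0

/-- The Gaussian Unitary Ensemble `GUE_p`, with density proportional to `exp(-tr(X²)/2)`
on Hermitian matrices. -/
noncomputable def gue (p : ℕ) : Measure (Matrix (Fin p) (Fin p) ℂ) :=
  mnormalize <| (hermLebesgue p).withDensity fun X =>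
    ENNReal.ofReal (Real.exp (-(X * X).trace.re / 2))

/-- Convergence in distribution of a sequence of laws to a limiting law. -/
def TendstoInDistribution {M : Type*} [MeasurableSpace M] [TopologicalSpace M]
    (μ : ℕ → Measure M) (ν : Measure M) : Prop :=
  ∀ f : BoundedContinuousFunction M ℝ,
    Tendsto (fun n => ∫ x, f x ∂(μ n)) atTop (𝓝 (∫ x, f x ∂ν))

/-- A sequence of measures satisfies a large deviation principle with speed `n` and good
rate function `I`: `I` is lower semicontinuous with compact sublevel sets, and for every
Borel set `A`,
`-inf_{Int A} I ≤ liminf (1/n) log μ_n(A) ≤ limsup (1/n) log μ_n(A) ≤ -inf_{Clo A} I`. -/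
def IsLDP {α : Type*} [TopologicalSpace α] [MeasurableSpace α]
    (μ : ℕ → Measure α) (I : α → EReal) : Prop :=
  LowerSemicontinuous I ∧ (∀ c : ℝ, IsCompact {x | I x ≤ (c : EReal)}) ∧
  ∀ A : Set α, MeasurableSet A →
    (-(⨅ x ∈ interior A, I x) ≤
        liminf (fun n : ℕ => (((n : ℝ)⁻¹ : ℝ) : EReal) * (μ n A).log) atTop ∧
      limsup (fun n : ℕ => (((n : ℝ)⁻¹ : ℝ) : EReal) * (μ n A).log) atTop ≤
        -(⨅ x ∈ closure A, I x))

/-- The real coordinate space of Hermitian `p × p` matrices. -/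
abbrev HermCoord (p : ℕ) : Type :=
  (Fin p → ℝ) × ({q : Fin p × Fin p // q.1 < q.2} → ℂ)

instance matrixBorelSpace (p : ℕ) : BorelSpace (Matrix (Fin p) (Fin p) ℂ) :=
  inferInstanceAs (BorelSpace (Fin p → Fin p → ℂ))

instance matrixSecondCountable (p : ℕ) :
    SecondCountableTopology (Matrix (Fin p) (Fin p) ℂ) :=
  inferInstanceAs (SecondCountableTopology (Fin p → Fin p → ℂ))

instance hermCoordHaar (p : ℕ) : (volume : Measure (HermCoord p)).IsAddHaarMeasure :=
  Measure.prod.instIsAddHaarMeasure (volume : Measure (Fin p → ℝ))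
    (volume : Measure ({q : Fin p × Fin p // q.1 < q.2} → ℂ))

lemma continuous_hermMk (p : ℕ) : Continuous (hermMk p) := by
  refine continuous_matrix fun i j => ?_
  unfold hermMk
  simp only [Matrix.of_apply]
  split_ifs <;> fun_prop

lemma isHermitian_hermMk {p : ℕ} (x : HermCoord p) : (hermMk p x).IsHermitian := by
  ext i j
  simp only [Matrix.conjTranspose_apply, hermMk, Matrix.of_apply]
  rcases lt_trichotomy i j with h | rfl | h
  · simp [h, h.not_gt]
  · simp
  · simp [h, h.not_gt]

lemma hermMk_smul {p : ℕ} (r : ℝ) (x : HermCoord p) : hermMk p (r • x) = r • hermMk p x := by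
  ext i j
  simp only [hermMk, Matrix.of_apply, Matrix.smul_apply]
  split_ifs <;> simp

lemma hermMk_sub {p : ℕ} (x y : HermCoord p) : hermMk p (x - y) = hermMk p x - hermMk p y := by
  ext i j
  simp only [hermMk, Matrix.of_apply, Matrix.sub_apply]
  split_ifs <;> simp

lemma hermMk_one {p : ℕ} : hermMk p (1, 0) = 1 := by
  ext i j
  simp only [hermMk, Matrix.of_apply, Matrix.one_apply]
  split_ifs <;> simp_all <;> omega

lemma norm_le_of_entry_le {p : ℕ} (x : HermCoord p) {C : ℝ} (hC : 0 ≤ C)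
    (h : ∀ i j, ‖hermMk p x i j‖ ≤ C) : ‖x‖ ≤ C := by
  rw [Prod.norm_def, max_le_iff, pi_norm_le_iff_of_nonneg hC, pi_norm_le_iff_of_nonneg hC]
  refine ⟨fun i => by simpa [hermMk] using h i i, fun q => ?_⟩
  simpa [hermMk, q.2] using h q.1.1 q.1.2

lemma measurableSet_posDef (p : ℕ) :
    MeasurableSet {X : Matrix (Fin p) (Fin p) ℂ | X.PosDef} := by
  have h : {X : Matrix (Fin p) (Fin p) ℂ | X.PosDef} =
      {X | X.PosSemidef} ∩ {X | X.det ≠ 0} := by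
    ext X
    simp only [Set.mem_ofPred_eq, Set.mem_inter_iff]
    refine ⟨fun hX => ⟨hX.posSemidef, hX.det_pos.ne'⟩, fun ⟨h1, h2⟩ => ?_⟩
    rw [h1.posDef_iff_isUnit, Matrix.isUnit_iff_isUnit_det]
    exact h2.isUnit
  rw [h]
  refine IsClosed.measurableSet ?_ |>.inter (IsOpen.measurableSet ?_)
  · simp only [Matrix.posSemidef_iff_dotProduct_mulVec, Set.ofPred_and, Set.ofPred_forall]
    refine IsClosed.inter ?_ (isClosed_iInter fun v => ?_)
    · exact isClosed_eq (by fun_prop) continuous_id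
    · exact isClosed_le continuous_const (by fun_prop)
  · exact isOpen_ne_fun (by fun_prop) continuous_const

section Spectral

variable {p : ℕ} {Y : Matrix (Fin p) (Fin p) ℂ}

lemma exists_unitary_diagonal (hY : Y.IsHermitian) :
    ∃ U : Matrix (Fin p) (Fin p) ℂ, U * star U = 1 ∧ star U * U = 1 ∧
      Y = U * Matrix.diagonal (fun i => (hY.eigenvalues i : ℂ)) * star U := by
  refine ⟨hY.eigenvectorUnitary, ?_, ?_, ?_⟩
  · simp
  · simp
  · conv_lhs => rw [hY.spectral_theorem, Unitary.conjStarAlgAut_apply]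
    rfl

lemma one_add_smul_eq (hY : Y.IsHermitian) :
    ∃ U : Matrix (Fin p) (Fin p) ℂ, U * star U = 1 ∧ star U * U = 1 ∧ ∀ c : ℝ, 1 + c • Y =
      U * Matrix.diagonal (fun i => ((1 + c * hY.eigenvalues i : ℝ) : ℂ)) * star U := by
  obtain ⟨U, h1, h2, h3⟩ := exists_unitary_diagonal hY
  refine ⟨U, h1, h2, fun c => ?_⟩
  have hd : Matrix.diagonal (fun i => ((1 + c * hY.eigenvalues i : ℝ) : ℂ)) =
      1 + c • Matrix.diagonal (fun i => (hY.eigenvalues i : ℂ)) := by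
    ext i j
    by_cases hij : i = j
    · subst hij; simp
    · simp [hij]
  rw [hd, mul_add, add_mul, mul_one, h1, Matrix.mul_smul, Matrix.smul_mul, ← h3]

lemma posDef_one_add_smul_iff (hY : Y.IsHermitian) (c : ℝ) :
    (1 + c • Y).PosDef ↔ ∀ i, 0 < 1 + c * hY.eigenvalues i := by
  obtain ⟨U, h1, h2, h3⟩ := one_add_smul_eq hY
  have hU : IsUnit U := ⟨⟨U, star U, h1, h2⟩, rfl⟩
  rw [h3, Matrix.IsUnit.posDef_star_right_conjugate_iff hU, Matrix.posDef_diagonal_iff]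
  exact forall_congr' fun i => by rw [Complex.zero_lt_real]

lemma det_one_add_smul (hY : Y.IsHermitian) (c : ℝ) :
    (1 + c • Y).det.re = ∏ i, (1 + c * hY.eigenvalues i) := by
  obtain ⟨U, h1, h2, h3⟩ := one_add_smul_eq hY
  rw [h3, Matrix.det_mul_right_comm, h1, one_mul, Matrix.det_diagonal, ← Complex.ofReal_prod,
    Complex.ofReal_re]

lemma trace_re_eq_sum (hY : Y.IsHermitian) : Y.trace.re = ∑ i, hY.eigenvalues i := by
  rw [hY.trace_eq_sum_eigenvalues]
  simp

lemma trace_mul_self_re_eq_sum (hY : Y.IsHermitian) :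
    (Y * Y).trace.re = ∑ i, hY.eigenvalues i ^ 2 := by
  obtain ⟨U, h1, h2, h3⟩ := exists_unitary_diagonal hY
  have : Y * Y = U * (Matrix.diagonal (fun i => (hY.eigenvalues i : ℂ)) *
      Matrix.diagonal (fun i => (hY.eigenvalues i : ℂ))) * star U := by
    conv_lhs => rw [h3]
    simp only [mul_assoc]
    rw [← mul_assoc (star U) U, h2, one_mul]
  rw [this, Matrix.trace_mul_cycle, h2, one_mul, Matrix.diagonal_mul_diagonal,
    Matrix.trace_diagonal, Complex.re_sum]
  exact Finset.sum_congr rfl fun i _ => by rw [← Complex.ofReal_mul, Complex.ofReal_re, sq]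

lemma norm_entry_le_sum_abs_eigenvalues (hY : Y.IsHermitian) (i j : Fin p) :
    ‖Y i j‖ ≤ ∑ k, |hY.eigenvalues k| := by
  have h1 : (Y * Y).trace.re = ∑ i, ∑ j, ‖Y i j‖ ^ 2 := by
    simp only [Matrix.trace, Matrix.diag_apply, Matrix.mul_apply, Complex.re_sum]
    refine Finset.sum_congr rfl fun i _ => Finset.sum_congr rfl fun j _ => ?_
    rw [← hY.apply j i, Complex.star_def, Complex.mul_conj, Complex.ofReal_re,
      Complex.normSq_eq_norm_sq]
  have h2 : ‖Y i j‖ ^ 2 ≤ ∑ k, hY.eigenvalues k ^ 2 := by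
    rw [← trace_mul_self_re_eq_sum hY, h1]
    calc ‖Y i j‖ ^ 2 ≤ ∑ j, ‖Y i j‖ ^ 2 :=
          Finset.single_le_sum (f := fun j => ‖Y i j‖ ^ 2) (fun _ _ => by positivity)
            (Finset.mem_univ j)
      _ ≤ _ := Finset.single_le_sum (f := fun i => ∑ j, ‖Y i j‖ ^ 2)
            (fun _ _ => by positivity) (Finset.mem_univ i)
  have h3 : ∑ k, hY.eigenvalues k ^ 2 ≤ (∑ k, |hY.eigenvalues k|) ^ 2 := by
    simpa using Finset.sum_sq_le_sq_sum_of_nonneg (s := Finset.univ)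
      (f := fun k => |hY.eigenvalues k|) (fun _ _ => abs_nonneg _)
  exact (pow_le_pow_iff_left₀ (norm_nonneg _) (Finset.sum_nonneg fun _ _ => abs_nonneg _)
    two_ne_zero).1 (h2.trans h3)

end Spectral

lemma log_one_add_sub_le {s l : ℝ} (hs : 2 ≤ s) (hl : 0 < 1 + s⁻¹ * l) :
    s ^ 2 * (Real.log (1 + s⁻¹ * l) - s⁻¹ * l) ≤ 2 - |l| / 2 := by
  have hs0 : 0 < s := by linarith
  have tangent : ∀ b : ℝ, 0 < 1 + b →
      Real.log (1 + s⁻¹ * l) ≤ (s⁻¹ * l - b) / (1 + b) + b := by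
    intro b hb
    have h1 := Real.log_le_sub_one_of_pos (div_pos hl hb)
    have h2 := Real.log_le_sub_one_of_pos hb
    rw [Real.log_div hl.ne' hb.ne'] at h1
    have : (1 + s⁻¹ * l) / (1 + b) - 1 = (s⁻¹ * l - b) / (1 + b) := by field_simp; ring
    linarith
  rcases le_total 0 l with h | h
  · have h1 := tangent s⁻¹ (by positivity)
    have h2 : s ^ 2 * (Real.log (1 + s⁻¹ * l) - s⁻¹ * l) ≤ s * (1 - l) / (s + 1) := by
      calc _ ≤ s ^ 2 * ((s⁻¹ * l - s⁻¹) / (1 + s⁻¹) + s⁻¹ - s⁻¹ * l) := by gcongr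
        _ = _ := by field_simp; ring
    refine h2.trans ?_
    rw [abs_of_nonneg h, div_le_iff₀ (by linarith)]
    nlinarith
  · have hb : 0 < 1 + -s⁻¹ := by
      have : s⁻¹ < 1 := inv_lt_one_of_one_lt₀ (by linarith)
      linarith
    have h1 := tangent (-s⁻¹) hb
    have hs1 : s - 1 ≠ 0 := by linarith
    have h2 : s ^ 2 * (Real.log (1 + s⁻¹ * l) - s⁻¹ * l) ≤ s * (1 + l) / (s - 1) := by
      calc _ ≤ s ^ 2 * ((s⁻¹ * l - -s⁻¹) / (1 + -s⁻¹) + -s⁻¹ - s⁻¹ * l) := by gcongr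
        _ = _ := by
          have : 1 + -s⁻¹ = (s - 1) / s := by field_simp; ring
          rw [this]; field_simp; ring
    refine h2.trans ?_
    rw [abs_of_nonpos h, div_le_iff₀ (by linarith)]
    nlinarith

/-- Logarithm of the contribution of an eigenvalue `l` to the rescaled Wishart density. -/
noncomputable def eigenExponent (p a l : ℝ) : ℝ :=
  (a - p) * Real.log (1 + (√a)⁻¹ * l) - √a * l

lemma eigenExponent_le {p a l : ℝ} (hp : 0 ≤ p) (ha : 2 * p ≤ a) (hs : 2 ≤ √a)
    (hs' : 8 * p ≤ √a) (hl : 0 < 1 + (√a)⁻¹ * l) : eigenExponent p a l ≤ 1 - |l| / 8 := by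
  have hs0 : 0 < √a := by linarith
  have ha0 : 0 < a := Real.sqrt_pos.1 hs0
  have h1 := log_one_add_sub_le hs hl
  rw [Real.sq_sqrt ha0.le] at h1
  set u := (√a)⁻¹ * l with hu
  have h2 : Real.log (1 + u) - u ≤ 0 := by
    have := Real.log_le_sub_one_of_pos hl; linarith
  have h3 : √a * l = a * u := by
    rw [hu]; nth_rewrite 2 [← Real.sq_sqrt ha0.le]; field_simp
  have h4 : -(p * u) ≤ |l| / 8 := by
    have : p * |u| ≤ |l| / 8 := by
      rw [hu, abs_mul, abs_of_pos (inv_pos.2 hs0)]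
      have : p * (√a)⁻¹ ≤ 1 / 8 := by
        rw [← div_eq_mul_inv, div_le_iff₀ hs0]; linarith
      nlinarith [abs_nonneg l]
    nlinarith [neg_abs_le u]
  unfold eigenExponent
  rw [h3]
  nlinarith

lemma tendsto_eigenExponent (p l : ℝ) :
    Tendsto (fun a => eigenExponent p a l) atTop (𝓝 (-l ^ 2 / 2)) := by
  have hinv : Tendsto (fun a : ℝ => (√a)⁻¹) atTop (𝓝 0) :=
    tendsto_inv_atTop_zero.comp Real.tendsto_sqrt_atTop
  have hu : Tendsto (fun a : ℝ => (√a)⁻¹ * l) atTop (𝓝 0) := by simpa using hinv.mul_const l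
  have hlog : Tendsto (fun a : ℝ => p * Real.log (1 + (√a)⁻¹ * l)) atTop (𝓝 0) := by
    have h : Tendsto (fun a : ℝ => 1 + (√a)⁻¹ * l) atTop (𝓝 1) := by
      simpa using hu.const_add 1
    simpa using (h.log one_ne_zero).const_mul p
  have hbound : Tendsto (fun a : ℝ => (√a)⁻¹ * |l| ^ 3 / (1 - |(√a)⁻¹ * l|)) atTop (𝓝 0) := by
    have h1 : Tendsto (fun a : ℝ => 1 - |(√a)⁻¹ * l|) atTop (𝓝 1) := by
      simpa using hu.abs.const_sub 1
    have h2 := (hinv.mul_const (|l| ^ 3)).div h1 one_ne_zero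
    rw [zero_mul, zero_div] at h2
    exact h2
  have hmain : Tendsto (fun a : ℝ => a * Real.log (1 + (√a)⁻¹ * l) - √a * l - (-l ^ 2 / 2))
      atTop (𝓝 0) := by
    refine squeeze_zero_norm' ?_ hbound
    have hlt : ∀ᶠ a : ℝ in atTop, |(√a)⁻¹ * l| < 1 := by
      have := hu.abs
      rw [abs_zero] at this
      exact this.eventually_lt_const one_pos
    filter_upwards [hlt, eventually_gt_atTop 0] with a h1 ha
    have hs0 : 0 < √a := Real.sqrt_pos.2 ha
    have h2 := Real.abs_log_sub_add_sum_range_le (x := -((√a)⁻¹ * l)) (by rwa [abs_neg]) 2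
    rw [abs_neg] at h2
    have h3 : a * Real.log (1 + (√a)⁻¹ * l) - √a * l - (-l ^ 2 / 2) =
        a * (∑ i ∈ Finset.range 2, (-((√a)⁻¹ * l)) ^ (i + 1) / ((i : ℝ) + 1) +
          Real.log (1 - -((√a)⁻¹ * l))) := by
      simp only [Finset.sum_range_succ, Finset.sum_range_zero, sub_neg_eq_add]
      push_cast
      have : a = √a ^ 2 := (Real.sq_sqrt ha.le).symm
      generalize √a = s at *
      subst this
      field_simp
      ring
    rw [h3, Real.norm_eq_abs, abs_mul, abs_of_pos ha]
    refine (mul_le_mul_of_nonneg_left h2 ha.le).trans_eq ?_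
    rw [abs_mul, abs_of_pos (inv_pos.2 hs0)]
    have : a = √a ^ 2 := (Real.sq_sqrt ha.le).symm
    generalize √a = s at *
    subst this
    rw [mul_pow, inv_pow, show 2 + 1 = 3 from rfl]
    field_simp
  have := (hmain.sub hlog).add_const (-l ^ 2 / 2)
  simp only [sub_zero, zero_add] at this
  refine this.congr fun a => ?_
  unfold eigenExponent
  ring

lemma integrable_exp_neg_mul_norm {E : Type*} [NormedAddCommGroup E] [NormedSpace ℝ E]
    [FiniteDimensional ℝ E] [MeasurableSpace E] [BorelSpace E] (μ : Measure E)
    [μ.IsAddHaarMeasure] {c : ℝ} (hc : 0 < c) : Integrable (fun x => Real.exp (-(c * ‖x‖))) μ := by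
  set n := Module.finrank ℝ E + 1 with hn
  have h := integrable_one_add_norm (E := E) (μ := μ) (r := (n : ℝ)) (by simp [hn])
  refine (h.const_mul (Real.exp c * (n.factorial / c ^ n))).mono'
    (Continuous.aestronglyMeasurable (by fun_prop)) (ae_of_all _ fun x => ?_)
  have h1 := Real.pow_div_factorial_le_exp (c * (1 + ‖x‖)) (by positivity) n
  rw [Real.norm_eq_abs, Real.abs_exp, Real.rpow_neg (by positivity), Real.rpow_natCast]
  have h2 : Real.exp (-(c * ‖x‖)) = Real.exp c / Real.exp (c * (1 + ‖x‖)) := by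
    rw [← Real.exp_sub]; ring_nf
  rw [h2, div_le_iff₀ (Real.exp_pos _)]
  calc Real.exp c = Real.exp c * (n.factorial / c ^ n) * ((1 + ‖x‖) ^ n)⁻¹ *
        ((c * (1 + ‖x‖)) ^ n / n.factorial) := by
        rw [mul_pow]; field_simp
    _ ≤ _ := by gcongr

lemma integral_mnormalize_hermLebesgue {p : ℕ} {g F : Matrix (Fin p) (Fin p) ℂ → ℝ}
    (hg : Measurable g) (hg0 : ∀ X, 0 ≤ g X) (hF : Measurable F) :
    ∫ X, F X ∂mnormalize ((hermLebesgue p).withDensity fun X => ENNReal.ofReal (g X)) =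
      (∫ x, g (hermMk p x))⁻¹ * ∫ x, g (hermMk p x) * F (hermMk p x) := by
  have hm : AEMeasurable (hermMk p) volume := (continuous_hermMk p).aemeasurable
  have hmass : (((hermLebesgue p).withDensity fun X => ENNReal.ofReal (g X)) Set.univ).toReal =
      ∫ x, g (hermMk p x) := by
    rw [withDensity_apply _ MeasurableSet.univ, Measure.restrict_univ,
      ← integral_eq_lintegral_of_nonneg_ae (ae_of_all _ hg0) hg.aestronglyMeasurable,
      hermLebesgue, integral_map hm hg.aestronglyMeasurable]
  rw [mnormalize, integral_smul_measure, ENNReal.toReal_inv, hmass, smul_eq_mul,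
    integral_withDensity_eq_integral_toReal_smul hg.ennreal_ofReal
      (ae_of_all _ fun _ => ENNReal.ofReal_lt_top)]
  simp only [ENNReal.toReal_ofReal (hg0 _), smul_eq_mul]
  rw [hermLebesgue, integral_map hm (f := fun X => g X * F X) (hg.mul hF).aestronglyMeasurable]

/-- The unnormalized Wishart density. -/
noncomputable def wishartDensity (p : ℕ) (a : ℝ) (X : Matrix (Fin p) (Fin p) ℂ) : ℝ :=
  if X.PosDef then Real.rpow X.det.re (a - p) * Real.exp (-X.trace.re) else 0

lemma wishartDensity_nonneg {p : ℕ} (a : ℝ) (X : Matrix (Fin p) (Fin p) ℂ) :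
    0 ≤ wishartDensity p a X := by
  unfold wishartDensity
  split_ifs with h
  · have : 0 ≤ X.det.re := (Complex.le_def.1 h.det_pos.le).1
    exact mul_nonneg (Real.rpow_nonneg this _) (Real.exp_nonneg _)
  · exact le_rfl

lemma measurable_det_re (p : ℕ) : Measurable fun X : Matrix (Fin p) (Fin p) ℂ => X.det.re :=
  Continuous.measurable (by fun_prop)

lemma measurable_wishartDensity (p : ℕ) (a : ℝ) : Measurable (wishartDensity p a) := by
  refine Measurable.ite (measurableSet_posDef p) ?_ measurable_const
  refine Measurable.mul ?_ ?_
  · exact (measurable_det_re p).pow_const (a - p)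
  · exact Continuous.measurable (by fun_prop)

lemma wishart_eq (p : ℕ) (a : ℝ) : wishart p a =
    mnormalize ((hermLebesgue p).withDensity fun X => ENNReal.ofReal (wishartDensity p a X)) := by
  unfold wishart wishartDensity
  congr 2
  ext X
  split_ifs <;> simp

/-- The density, up to a constant factor, of the centred and rescaled Wishart distribution. -/
noncomputable def rescaledDensity (p : ℕ) (a : ℝ) (Y : Matrix (Fin p) (Fin p) ℂ) : ℝ :=
  if (1 + (√a)⁻¹ • Y).PosDef then
    Real.rpow (1 + (√a)⁻¹ • Y).det.re (a - p) * Real.exp (-(√a * Y.trace.re))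
  else 0

lemma measurable_rescaledDensity (p : ℕ) (a : ℝ) : Measurable (rescaledDensity p a) := by
  have hc : Continuous fun Y : Matrix (Fin p) (Fin p) ℂ => 1 + (√a)⁻¹ • Y := by fun_prop
  refine Measurable.ite (hc.measurable (measurableSet_posDef p)) ?_ measurable_const
  refine Measurable.mul ?_ ?_
  · exact ((measurable_det_re p).comp hc.measurable).pow_const (a - p)
  · exact Continuous.measurable (by fun_prop)

lemma wishartDensity_eq_rescaledDensity {p : ℕ} {a : ℝ} (ha : 0 < a)
    (X : Matrix (Fin p) (Fin p) ℂ) :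
    wishartDensity p a X = (a ^ p) ^ (a - p) * Real.exp (-(a * p)) *
      rescaledDensity p a ((√a)⁻¹ • (X - a • (1 : Matrix (Fin p) (Fin p) ℂ))) := by
  obtain ⟨Y, rfl⟩ : ∃ Y : Matrix (Fin p) (Fin p) ℂ, X = a • (1 + (√a)⁻¹ • Y) := by
    refine ⟨√a • (a⁻¹ • X - 1), ?_⟩
    rw [smul_smul, inv_mul_cancel₀ (Real.sqrt_pos.2 ha).ne', one_smul, add_sub_cancel, smul_smul,
      mul_inv_cancel₀ ha.ne', one_smul]
  have hs0 := Real.sqrt_pos.2 ha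
  have hY : (√a)⁻¹ • (a • (1 + (√a)⁻¹ • Y) - a • (1 : Matrix (Fin p) (Fin p) ℂ)) = Y := by
    rw [smul_add, add_sub_cancel_left, smul_smul, smul_smul]
    have : (√a)⁻¹ * a * (√a)⁻¹ = 1 := by
      nth_rewrite 2 [← Real.sq_sqrt ha.le]
      field_simp
    rw [this, one_smul]
  rw [hY]
  unfold wishartDensity rescaledDensity
  have hpd : (a • (1 + (√a)⁻¹ • Y)).PosDef ↔ (1 + (√a)⁻¹ • Y).PosDef := by
    refine ⟨fun h => ?_, fun h => h.smul ha⟩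
    have h' := h.smul (inv_pos.2 ha)
    rwa [smul_smul, inv_mul_cancel₀ ha.ne', one_smul] at h'
  by_cases h : (1 + (√a)⁻¹ • Y).PosDef
  · rw [if_pos h, if_pos (hpd.2 h)]
    have hdet : 0 ≤ (1 + (√a)⁻¹ • Y).det.re := (Complex.le_def.1 h.det_pos.le).1
    have h1 : (a • (1 + (√a)⁻¹ • Y)).det.re = a ^ p * (1 + (√a)⁻¹ • Y).det.re := by
      rw [← Complex.coe_smul, Matrix.det_smul, Fintype.card_fin, ← Complex.ofReal_pow,
        Complex.re_ofReal_mul]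
    have h2 : (a • (1 + (√a)⁻¹ • Y)).trace.re = a * p + √a * Y.trace.re := by
      rw [Matrix.trace_smul, Matrix.trace_add, Matrix.trace_smul, Matrix.trace_one,
        Fintype.card_fin, Complex.smul_re, Complex.add_re, Complex.smul_re, Complex.natCast_re,
        smul_eq_mul, smul_eq_mul]
      nth_rewrite 1 3 [← Real.sq_sqrt ha.le]
      field_simp
    simp only [Real.rpow_eq_pow]
    rw [h1, h2, Real.mul_rpow (by positivity) hdet, neg_add, Real.exp_add]
    ring
  · rw [if_neg h, if_neg (fun h' => h (hpd.1 h')), mul_zero]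

lemma rescaledDensity_eq_exp {p : ℕ} {a : ℝ} {Y : Matrix (Fin p) (Fin p) ℂ}
    (hY : Y.IsHermitian) (h : ∀ i, 0 < 1 + (√a)⁻¹ * hY.eigenvalues i) :
    rescaledDensity p a Y = Real.exp (∑ i, eigenExponent p a (hY.eigenvalues i)) := by
  rw [rescaledDensity, if_pos ((posDef_one_add_smul_iff hY _).2 h), det_one_add_smul hY,
    trace_re_eq_sum hY, Real.rpow_eq_pow,
    Real.rpow_def_of_pos (Finset.prod_pos fun i _ => h i), ← Real.exp_add,
    Real.log_prod fun i _ => (h i).ne']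
  simp only [eigenExponent, Finset.sum_sub_distrib, ← Finset.mul_sum]
  ring_nf

lemma norm_rescaledDensity_le {p : ℕ} {a : ℝ} (ha : 2 * p ≤ a) (hs : 2 ≤ √a)
    (hs' : 8 * p ≤ √a) (x : HermCoord p) :
    ‖rescaledDensity p a (hermMk p x)‖ ≤ Real.exp p * Real.exp (-(1 / 8 * ‖x‖)) := by
  have hY := isHermitian_hermMk x
  by_cases h : ∀ i, 0 < 1 + (√a)⁻¹ * hY.eigenvalues i
  · rw [rescaledDensity_eq_exp hY h, Real.norm_eq_abs, Real.abs_exp, ← Real.exp_add,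
      Real.exp_le_exp]
    have hx : ‖x‖ ≤ ∑ k, |hY.eigenvalues k| :=
      norm_le_of_entry_le x (Finset.sum_nonneg fun _ _ => abs_nonneg _)
        (norm_entry_le_sum_abs_eigenvalues hY)
    calc ∑ i, eigenExponent p a (hY.eigenvalues i)
        ≤ ∑ i : Fin p, (1 - |hY.eigenvalues i| / 8) := Finset.sum_le_sum fun i _ =>
          eigenExponent_le (Nat.cast_nonneg p) ha hs hs' (h i)
      _ = p - (∑ k, |hY.eigenvalues k|) / 8 := by
          rw [Finset.sum_sub_distrib, ← Finset.sum_div]; simp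
      _ ≤ _ := by linarith
  · rw [rescaledDensity, if_neg (fun h' => h ((posDef_one_add_smul_iff hY _).1 h')), norm_zero]
    positivity

lemma tendsto_rescaledDensity {p : ℕ} {Y : Matrix (Fin p) (Fin p) ℂ} (hY : Y.IsHermitian) :
    Tendsto (fun a => rescaledDensity p a Y) atTop (𝓝 (Real.exp (-(Y * Y).trace.re / 2))) := by
  have hlim : -(Y * Y).trace.re / 2 = ∑ i, -hY.eigenvalues i ^ 2 / 2 := by
    rw [trace_mul_self_re_eq_sum hY, ← Finset.sum_div, Finset.sum_neg_distrib]
  rw [hlim]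
  have hpos : ∀ᶠ a : ℝ in atTop, ∀ i, 0 < 1 + (√a)⁻¹ * hY.eigenvalues i := by
    refine eventually_all.2 fun i => ?_
    have h : Tendsto (fun a : ℝ => 1 + (√a)⁻¹ * hY.eigenvalues i) atTop (𝓝 1) := by
      simpa using ((tendsto_inv_atTop_zero.comp Real.tendsto_sqrt_atTop).mul_const
        (hY.eigenvalues i)).const_add 1
    exact h.eventually_const_lt one_pos
  refine Tendsto.congr' ?_ ((Real.continuous_exp.tendsto _).comp
    (tendsto_finsetSum _ fun i _ => tendsto_eigenExponent p (hY.eigenvalues i)))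
  filter_upwards [hpos] with a h
  exact (rescaledDensity_eq_exp hY h).symm

lemma eventually_norm_rescaledDensity_le {p : ℕ} {a : ℕ → ℝ} (ha : Tendsto a atTop atTop) :
    ∀ᶠ n in atTop, ∀ x : HermCoord p,
      ‖rescaledDensity p (a n) (hermMk p x)‖ ≤ Real.exp p * Real.exp (-(1 / 8 * ‖x‖)) := by
  have hs := Real.tendsto_sqrt_atTop.comp ha
  filter_upwards [ha.eventually_ge_atTop (2 * p), hs.eventually_ge_atTop 2,
    hs.eventually_ge_atTop (8 * p)] with n h1 h2 h3
  exact norm_rescaledDensity_le h1 h2 h3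

lemma integrable_exp_neg_trace_sq (p : ℕ) : Integrable fun x : HermCoord p =>
    Real.exp (-(hermMk p x * hermMk p x).trace.re / 2) := by
  have hc := continuous_hermMk p
  refine ((integrable_exp_neg_mul_norm volume (show (0 : ℝ) < 1 / 8 by norm_num)).const_mul
    (Real.exp p)).mono' (Continuous.aestronglyMeasurable (by fun_prop)) (ae_of_all _ fun x => ?_)
  refine le_of_tendsto ((tendsto_rescaledDensity (isHermitian_hermMk x)).comp
    tendsto_natCast_atTop_atTop).norm ?_
  filter_upwards [eventually_norm_rescaledDensity_le tendsto_natCast_atTop_atTop] with n hn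
  exact hn x

lemma tendsto_integral_rescaledDensity_mul {p : ℕ} {a : ℕ → ℝ} (ha : Tendsto a atTop atTop)
    {F : Matrix (Fin p) (Fin p) ℂ → ℝ} (hF : Measurable F) {C : ℝ} (hC : ∀ X, ‖F X‖ ≤ C) :
    Tendsto (fun n => ∫ x, rescaledDensity p (a n) (hermMk p x) * F (hermMk p x)) atTop
      (𝓝 (∫ x, Real.exp (-(hermMk p x * hermMk p x).trace.re / 2) * F (hermMk p x))) := by
  refine tendsto_integral_filter_of_dominated_convergence
    (fun x => Real.exp p * Real.exp (-(1 / 8 * ‖x‖)) * C) ?_ ?_ ?_ ?_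
  · exact Eventually.of_forall fun n => (((measurable_rescaledDensity p (a n)).mul hF).comp
      (continuous_hermMk p).measurable).aestronglyMeasurable
  · filter_upwards [eventually_norm_rescaledDensity_le ha] with n hn
    refine ae_of_all _ fun x => ?_
    rw [norm_mul]
    exact mul_le_mul (hn x) (hC _) (norm_nonneg _) (by positivity)
  · exact ((integrable_exp_neg_mul_norm volume (by norm_num)).const_mul _).mul_const _
  · exact ae_of_all _ fun x =>
      ((tendsto_rescaledDensity (isHermitian_hermMk x)).comp ha).mul_const _

lemma integral_rescaled_wishart {p : ℕ} {a : ℝ} (ha : 0 < a)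
    {F : Matrix (Fin p) (Fin p) ℂ → ℝ} (hF : Measurable F) :
    ∫ X, F X ∂Measure.map (fun X : Matrix (Fin p) (Fin p) ℂ =>
        (√a)⁻¹ • (X - a • (1 : Matrix (Fin p) (Fin p) ℂ))) (wishart p a) =
      (∫ x, rescaledDensity p a (hermMk p x))⁻¹ *
        ∫ x, rescaledDensity p a (hermMk p x) * F (hermMk p x) := by
  have hT : Continuous fun X : Matrix (Fin p) (Fin p) ℂ =>
    (√a)⁻¹ • (X - a • (1 : Matrix (Fin p) (Fin p) ℂ)) := by fun_prop
  have hchange : ∀ G : Matrix (Fin p) (Fin p) ℂ → ℝ,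
      ∫ x, G ((√a)⁻¹ • (hermMk p x - a • (1 : Matrix (Fin p) (Fin p) ℂ))) =
        |√a ^ Module.finrank ℝ (HermCoord p)| * ∫ x, G (hermMk p x) := by
    intro G
    have h := Measure.integral_comp_inv_smul (volume : Measure (HermCoord p))
      (fun x => G (hermMk p x)) (√a)
    rw [← integral_sub_right_eq_self _ (a • ((1, 0) : HermCoord p))] at h
    simpa only [hermMk_smul, hermMk_sub, hermMk_one, smul_eq_mul] using h
  rw [integral_map hT.aemeasurable hF.aestronglyMeasurable, wishart_eq,
    integral_mnormalize_hermLebesgue (F := fun X => F ((√a)⁻¹ • (X - a • 1)))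
      (measurable_wishartDensity p a) (wishartDensity_nonneg a) (hF.comp hT.measurable)]
  simp only [wishartDensity_eq_rescaledDensity ha, mul_assoc, integral_const_mul]
  rw [hchange (rescaledDensity p a), hchange fun X => rescaledDensity p a X * F X]
  have hs0 := Real.sqrt_pos.2 ha
  have h1 : (a ^ p) ^ (a - p) ≠ 0 := (Real.rpow_pos_of_pos (by positivity) _).ne'
  have h2 : |√a ^ Module.finrank ℝ (HermCoord p)| ≠ 0 := by positivity
  have h3 := Real.exp_ne_zero (-(a * p))
  generalize |√a ^ Module.finrank ℝ (HermCoord p)| = c at *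
  generalize (a ^ p) ^ (a - p) = d at *
  simp only [mul_inv]
  field_simp

/-- If `W_n ~ W_p(a_n)` with `a_n → ∞`, then `a_n^{-1/2} (W_n - a_n I)` converges in
distribution to `GUE_p`. -/
theorem wishart_clt (p : ℕ) (a : ℕ → ℝ) (hpos : ∀ n, 0 < a n)
    (ha : Tendsto a atTop atTop) :
    TendstoInDistribution
      (fun n => Measure.map
        (fun X : Matrix (Fin p) (Fin p) ℂ =>
          (Real.sqrt (a n))⁻¹ • (X - a n • (1 : Matrix (Fin p) (Fin p) ℂ)))
        (wishart p (a n)))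
      (gue p) := by
  intro f
  have hlim := tendsto_integral_rescaledDensity_mul (p := p) ha f.continuous.measurable
    f.norm_coe_le_norm
  have hmass := tendsto_integral_rescaledDensity_mul (p := p) (F := fun _ => 1) (C := 1) ha
    measurable_const (fun _ => by simp)
  simp only [mul_one] at hmass
  have : NeZero (volume : Measure (HermCoord p)) := by
    have := (hermCoordHaar p).toIsOpenPosMeasure
    infer_instance
  have hne : ∫ x, Real.exp (-(hermMk p x * hermMk p x).trace.re / 2) ≠ 0 :=
    (integral_exp_pos (integrable_exp_neg_trace_sq p)).ne'
  have hgue : ∫ X, f X ∂gue p = (∫ x, Real.exp (-(hermMk p x * hermMk p x).trace.re / 2))⁻¹ *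
      ∫ x, Real.exp (-(hermMk p x * hermMk p x).trace.re / 2) * f (hermMk p x) :=
    integral_mnormalize_hermLebesgue
      (g := fun X : Matrix (Fin p) (Fin p) ℂ => Real.exp (-(X * X).trace.re / 2))
      (Continuous.measurable (by fun_prop)) (fun _ => Real.exp_nonneg _) f.continuous.measurable
  rw [hgue]
  refine ((hmass.inv₀ hne).mul hlim).congr fun n => ?_
  exact (integral_rescaled_wishart (hpos n) f.continuous.measurable).symm
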